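/- arXiv:1805.11897 — 5 statements merged into one kernel-verified Lean document; each statement's English description precedes it below -/
import Mathlib

section
/- If a lies in the interior of Δ_n and b lies in the interior of Δ_m, then every entry of the unique minimizer T_λ(a,b) of T ↦ ⟨T,M⟩ - h(T)/λ over Π(a,b) is strictly positive. -/
open scoped BigOperators

noncomputable section

/-- The transportation polytope `Π(a,b)`: `n × m` matrices with nonnegative entries,
row sums `a` and column sums `b`. -/
def transportPolytope {n m : ℕ} (a : Fin n → ℝ) (b : Fin m → ℝ) :
    Set (Matrix (Fin n) (Fin m) ℝ) :=
  {T | (∀ i j, 0 ≤ T i j) ∧ (∀ i, ∑ j, T i j = a i) ∧ (∀ j, ∑ i, T i j = b j)}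

/-- Frobenius inner product `⟨T, M⟩ = Tr(Tᵀ M)`. -/
def frob {n m : ℕ} (T M : Matrix (Fin n) (Fin m) ℝ) : ℝ :=
  ∑ i, ∑ j, T i j * M i j

/-- Entropy `h(T) = -∑ T_ij (log T_ij - 1)`, with the convention `0 log 0 = 0`
(automatic since `Real.log 0 = 0`). -/
def ent {n m : ℕ} (T : Matrix (Fin n) (Fin m) ℝ) : ℝ :=
  -∑ i, ∑ j, T i j * (Real.log (T i j) - 1)


/-- The entrywise cost `x ↦ x c + x (log x - 1) / lam` of entropic optimal transport. -/
def entropicCost (lam c x : ℝ) : ℝ :=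
  x * c + x * (Real.log x - 1) / lam

lemma frob_sub_ent_div_eq_sum_entropicCost {n m : ℕ} (T M : Matrix (Fin n) (Fin m) ℝ) (lam : ℝ) :
    frob T M - ent T / lam = ∑ i, ∑ j, entropicCost lam (M i j) (T i j) := by
  simp only [frob, ent, entropicCost, neg_div, sub_neg_eq_add, Finset.sum_add_distrib,
    Finset.sum_div]

lemma entropicCost_convex_combination_le {lam : ℝ} (hlam : 0 < lam) (c : ℝ) {x r t : ℝ}
    (hx : 0 ≤ x) (hr : 0 ≤ r) (ht : 0 ≤ t) (ht1 : t ≤ 1) :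
    entropicCost lam c ((1 - t) * x + t * r) ≤
      (1 - t) * entropicCost lam c x + t * entropicCost lam c r := by
  have h := Real.convexOn_mul_log.2 (Set.mem_Ici.2 hx) (Set.mem_Ici.2 hr) (sub_nonneg.2 ht1) ht
    (by ring)
  simp only [smul_eq_mul] at h
  have h' := div_le_div_of_nonneg_right h hlam.le
  simp only [entropicCost]
  linear_combination h'

lemma entropicCost_mul (lam c : ℝ) {r t : ℝ} (hr : 0 < r) (ht : 0 < t) :
    entropicCost lam c (t * r) = t * entropicCost lam c r + t * (r * Real.log t / lam) := by
  simp only [entropicCost, Real.log_mul ht.ne' hr.ne']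
  ring

lemma convex_transportPolytope {n m : ℕ} (a : Fin n → ℝ) (b : Fin m → ℝ) :
    Convex ℝ (transportPolytope a b) := by
  rintro T ⟨hT, hTa, hTb⟩ R ⟨hR, hRa, hRb⟩ s t hs ht hst
  refine ⟨fun i j => ?_, fun i => ?_, fun j => ?_⟩
  · exact add_nonneg (mul_nonneg hs (hT i j)) (mul_nonneg ht (hR i j))
  · simp only [Matrix.add_apply, Matrix.smul_apply, smul_eq_mul, Finset.sum_add_distrib,
      ← Finset.mul_sum, hTa, hRa, ← add_mul, hst, one_mul]
  · simp only [Matrix.add_apply, Matrix.smul_apply, smul_eq_mul, Finset.sum_add_distrib,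
      ← Finset.mul_sum, hTb, hRb, ← add_mul, hst, one_mul]

lemma vecMulVec_mem_transportPolytope {n m : ℕ} {a : Fin n → ℝ} {b : Fin m → ℝ}
    (ha : a ∈ stdSimplex ℝ (Fin n)) (hb : b ∈ stdSimplex ℝ (Fin m)) :
    Matrix.vecMulVec a b ∈ transportPolytope a b := by
  refine ⟨fun i j => mul_nonneg (ha.1 i) (hb.1 j), fun i => ?_, fun j => ?_⟩
  · simp only [Matrix.vecMulVec_apply, ← Finset.mul_sum, hb.2, mul_one]
  · simp only [Matrix.vecMulVec_apply, ← Finset.sum_mul, ha.2, one_mul]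

/-- Moving from `T` towards `R`, an entry vanishing at `T` but not at `R` contributes a
term of order `t log t`, beyond the bound given by convexity. -/
lemma sum_entropicCost_convex_combination_le {n m : ℕ} {T R : Matrix (Fin n) (Fin m) ℝ}
    (M : Matrix (Fin n) (Fin m) ℝ) {lam t : ℝ} (hlam : 0 < lam) (ht : 0 < t) (ht1 : t ≤ 1)
    (hT : ∀ i j, 0 ≤ T i j) (hR : ∀ i j, 0 ≤ R i j) {k : Fin n} {l : Fin m}
    (hTkl : T k l = 0) (hRkl : 0 < R k l) :
    ∑ i, ∑ j, entropicCost lam (M i j) ((1 - t) * T i j + t * R i j) ≤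
      (1 - t) * (∑ i, ∑ j, entropicCost lam (M i j) (T i j)) +
        t * (∑ i, ∑ j, entropicCost lam (M i j) (R i j)) + t * (R k l * Real.log t / lam) := by
  calc
    _ ≤ ∑ i, ∑ j, ((1 - t) * entropicCost lam (M i j) (T i j) +
          t * entropicCost lam (M i j) (R i j) +
          if i = k then if j = l then t * (R k l * Real.log t / lam) else 0 else 0) := by
      refine Finset.sum_le_sum fun i _ => Finset.sum_le_sum fun j _ => ?_
      by_cases h : i = k ∧ j = l
      · obtain ⟨rfl, rfl⟩ := h
        simp only [hTkl, mul_zero, zero_add, if_true, entropicCost_mul lam _ hRkl ht]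
        simp [entropicCost]
      · rw [← ite_and, if_neg h, add_zero]
        exact entropicCost_convex_combination_le hlam _ (hT i j) (hR i j) ht.le ht1
    _ = _ := by
      simp [Finset.sum_add_distrib, Finset.mul_sum, Finset.sum_ite_irrel]

/-- if `a` lies in the interior of `Δ_n` (all entries positive) and `b` in the
interior of `Δ_m`, then every entry of the unique minimizer `T_λ(a,b)` of
`T ↦ ⟨T,M⟩ - h(T)/λ` over `Π(a,b)` is strictly positive. -/
theorem statement1 {n m : ℕ} (hn : 1 ≤ n) (hm : 1 ≤ m)
    (M : Matrix (Fin n) (Fin m) ℝ) (lam : ℝ) (hlam : 0 < lam)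
    (a : Fin n → ℝ) (ha : a ∈ stdSimplex ℝ (Fin n)) (ha' : ∀ i, 0 < a i)
    (b : Fin m → ℝ) (hb : b ∈ stdSimplex ℝ (Fin m)) (hb' : ∀ j, 0 < b j)
    (T : Matrix (Fin n) (Fin m) ℝ) (hT : T ∈ transportPolytope a b)
    (hTmin : IsMinOn (fun T => frob T M - ent T / lam) (transportPolytope a b) T) :
    ∀ i j, 0 < T i j := by
  by_contra! h
  obtain ⟨k, l, hkl⟩ := h
  have hTkl : T k l = 0 := le_antisymm hkl (hT.1 k l)
  set R := Matrix.vecMulVec a b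
  have hR : R ∈ transportPolytope a b := vecMulVec_mem_transportPolytope ha hb
  have hRkl : 0 < R k l := mul_pos (ha' k) (hb' l)
  set F := ∑ i, ∑ j, entropicCost lam (M i j) (T i j) with hF
  set G := ∑ i, ∑ j, entropicCost lam (M i j) (R i j) with hG
  set K := lam * (|G - F| + 1) / R k l with hK
  have hK0 : 0 ≤ K := by positivity
  have ht : 0 < Real.exp (-K) := Real.exp_pos _
  have ht1 : Real.exp (-K) ≤ 1 := Real.exp_le_one_iff.2 (neg_nonpos.2 hK0)
  have hmin := hTmin (convex_transportPolytope a b hT hR (sub_nonneg.2 ht1) ht.le (by ring))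
  simp only [Set.mem_ofPred_eq, frob_sub_ent_div_eq_sum_entropicCost, Matrix.add_apply,
    Matrix.smul_apply, smul_eq_mul] at hmin
  have hle := hmin.trans
    (sum_entropicCost_convex_combination_le M hlam ht ht1 hT.1 hR.1 hTkl hRkl)
  rw [← hF, ← hG, Real.log_exp] at hle
  have hlog : R k l * -K / lam = -(|G - F| + 1) := by
    rw [hK]
    field_simp
  rw [hlog] at hle
  have hneg : G - F - (|G - F| + 1) < 0 := by linarith [le_abs_self (G - F)]
  linarith [mul_neg_of_pos_of_neg ht hneg]
end
end

section
/- For every λ > 0, the regularized Sinkhorn distance S̃_λ : Δ_n × Δ_m → ℝ, S̃_λ(a,b) = min_{T ∈ Π(a,b)} ⟨T,M⟩ - h(T)/λ, is infinitely differentiable (C^∞) on the interior of Δ_n × Δ_m. -/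
open scoped BigOperators

noncomputable section

/-- The interior of `Δ_n × Δ_m`: pairs of strictly positive vectors summing to one. -/
def intSimplexPairs (n m : ℕ) : Set ((Fin n → ℝ) × (Fin m → ℝ)) :=
  {p | (∀ i, 0 < p.1 i) ∧ (∑ i, p.1 i = 1) ∧ (∀ j, 0 < p.2 j) ∧ (∑ j, p.2 j = 1)}

open scoped Topology ContDiff
open Filter

section ExpGradient

variable {E ι : Type*} [NormedAddCommGroup E] [NormedSpace ℝ E] [Fintype ι]

/-- The gradient of `x ↦ ∑ k, w k * exp (ℓ k x) + (s x) ^ 2 / 2`. -/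
def expGradient (w : ι → ℝ) (ℓ : ι → E →L[ℝ] ℝ) (s : E →L[ℝ] ℝ) (x : E) : E →L[ℝ] ℝ :=
  ∑ k, (w k * Real.exp (ℓ k x)) • ℓ k + s x • s

lemma expGradient_apply (w : ι → ℝ) (ℓ : ι → E →L[ℝ] ℝ) (s : E →L[ℝ] ℝ) (x v : E) :
    expGradient w ℓ s x v = ∑ k, w k * Real.exp (ℓ k x) * ℓ k v + s x * s v := by
  simp [expGradient]

lemma contDiff_expGradient (w : ι → ℝ) (ℓ : ι → E →L[ℝ] ℝ) (s : E →L[ℝ] ℝ) :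
    ContDiff ℝ ∞ (expGradient w ℓ s) := by
  unfold expGradient
  fun_prop

lemma hasFDerivAt_expGradient (w : ι → ℝ) (ℓ : ι → E →L[ℝ] ℝ) (s : E →L[ℝ] ℝ) (x : E) :
    HasFDerivAt (expGradient w ℓ s)
      (∑ k, ((w k * Real.exp (ℓ k x)) • ℓ k).smulRight (ℓ k) + s.smulRight s) x := by
  unfold expGradient
  refine HasFDerivAt.add (HasFDerivAt.fun_sum fun k _ => ?_) (s.hasFDerivAt.smul_const s)
  have h := (((ℓ k).hasFDerivAt (x := x)).exp.const_mul (w k)).smul_const (ℓ k)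
  rwa [smul_smul] at h

/-- If `w > 0` and the functionals `ℓ k`, `s` separate points, then `expGradient w ℓ s` has a
smooth local right inverse at each of its values. -/
lemma exists_contDiffAt_rightInverse_expGradient [FiniteDimensional ℝ E]
    {w : ι → ℝ} (hw : ∀ k, 0 < w k) {ℓ : ι → E →L[ℝ] ℝ} {s : E →L[ℝ] ℝ}
    (hsep : ∀ v, (∀ k, ℓ k v = 0) → s v = 0 → v = 0) (x : E) :
    ∃ g : (E →L[ℝ] ℝ) → E, ContDiffAt ℝ ∞ g (expGradient w ℓ s x) ∧
      ∀ᶠ q in 𝓝 (expGradient w ℓ s x), expGradient w ℓ s (g q) = q := by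
  have : CompleteSpace E := FiniteDimensional.complete ℝ E
  set D : E →L[ℝ] (E →L[ℝ] ℝ) :=
    ∑ k, ((w k * Real.exp (ℓ k x)) • ℓ k).smulRight (ℓ k) + s.smulRight s with hD
  have hinj : Function.Injective (D : E →ₗ[ℝ] (E →L[ℝ] ℝ)) := by
    rw [← LinearMap.ker_eq_bot, LinearMap.ker_eq_bot']
    intro v hv
    have h0 : ∑ k, w k * Real.exp (ℓ k x) * (ℓ k v) ^ 2 + (s v) ^ 2 = 0 := by
      have h1 : D v v = 0 := by
        have : D v = 0 := hv
        simp [this]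
      rw [← h1]
      simp [hD, pow_two, mul_assoc]
    have hnn : ∀ k ∈ Finset.univ, 0 ≤ w k * Real.exp (ℓ k x) * (ℓ k v) ^ 2 := fun k _ =>
      mul_nonneg (mul_pos (hw k) (Real.exp_pos _)).le (sq_nonneg _)
    have hsum := Finset.sum_nonneg hnn
    have hs : s v = 0 := by
      have : (s v) ^ 2 = 0 := by nlinarith [sq_nonneg (s v)]
      simpa using this
    have hz : ∑ k, w k * Real.exp (ℓ k x) * (ℓ k v) ^ 2 = 0 := by
      nlinarith [sq_nonneg (s v)]
    refine hsep v (fun k => ?_) hs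
    have hk := (Finset.sum_eq_zero_iff_of_nonneg hnn).1 hz k (Finset.mem_univ k)
    simpa [(hw k).ne', Real.exp_ne_zero] using hk
  have hdim : Module.finrank ℝ E = Module.finrank ℝ (E →L[ℝ] ℝ) := by
    rw [← (LinearMap.toContinuousLinearMap (𝕜 := ℝ) (E := E) (F' := ℝ)).finrank_eq]
    exact (Subspace.dual_finrank_eq (K := ℝ) (V := E)).symm
  set e : E ≃L[ℝ] (E →L[ℝ] ℝ) :=
    (LinearMap.linearEquivOfInjective (D : E →ₗ[ℝ] (E →L[ℝ] ℝ)) hinj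
      hdim).toContinuousLinearEquiv with he
  have hde : HasFDerivAt (expGradient w ℓ s) (e : E →L[ℝ] (E →L[ℝ] ℝ)) x := by
    have hed : (e : E →L[ℝ] (E →L[ℝ] ℝ)) = D := by
      ext1 v
      rfl
    rw [hed]
    exact hasFDerivAt_expGradient w ℓ s x
  have hc : ContDiffAt ℝ ∞ (expGradient w ℓ s) x := (contDiff_expGradient w ℓ s).contDiffAt
  have hstrict := hc.hasStrictFDerivAt' hde (by simp)
  exact ⟨hc.localInverse hde (by simp), hc.to_localInverse hde (by simp),
    hstrict.eventually_right_inverse⟩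

lemma exists_mul_abs_sub_le_mul_exp_sub {w c : ℝ} (hw : 0 < w) (hc : 0 < c) :
    ∃ K : ℝ, ∀ u : ℝ, c * |u| - K ≤ w * Real.exp u - c * u := by
  set t := Real.log (2 * c / w) with ht
  have het : w * Real.exp t = 2 * c := by
    rw [ht, Real.exp_log (by positivity)]
    field_simp
  refine ⟨2 * c * |t - 1|, fun u => ?_⟩
  have h1 : 2 * c * (u - t + 1) ≤ w * Real.exp u := by
    have : w * Real.exp u = 2 * c * Real.exp (u - t) := by
      rw [← het, mul_assoc, ← Real.exp_add]; ring_nf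
    rw [this]
    exact mul_le_mul_of_nonneg_left (Real.add_one_le_exp _) (by positivity)
  have h2 : 0 < w * Real.exp u := mul_pos hw (Real.exp_pos u)
  have h3 : 2 * c * (t - 1) ≤ 2 * c * |t - 1| :=
    mul_le_mul_of_nonneg_left (le_abs_self _) (by positivity)
  have h4 : 0 ≤ 2 * c * |t - 1| := by positivity
  rcases abs_cases u with ⟨h, _⟩ | ⟨h, _⟩ <;> rw [h] <;> linarith

/-- If `w > 0` and the functionals `ℓ k`, `s` separate points, then every positive combination of
the `ℓ k` is a value of `expGradient w ℓ s`. -/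
lemma exists_expGradient_eq [FiniteDimensional ℝ E]
    {w c : ι → ℝ} (hw : ∀ k, 0 < w k) (hc : ∀ k, 0 < c k) {ℓ : ι → E →L[ℝ] ℝ} {s : E →L[ℝ] ℝ}
    (hsep : ∀ v, (∀ k, ℓ k v = 0) → s v = 0 → v = 0) :
    ∃ x, expGradient w ℓ s x = ∑ k, c k • ℓ k := by
  have : ProperSpace E := FiniteDimensional.proper ℝ E
  set J : E → ℝ := fun x => ∑ k, (w k * Real.exp (ℓ k x) - c k * ℓ k x) + (s x) ^ 2 / 2 with hJ
  have hcont : Continuous J := by fun_prop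
  choose K hK using fun k => exists_mul_abs_sub_le_mul_exp_sub (hw k) (hc k)
  have hterm : ∀ x k, c k * |ℓ k x| ≤ J x + ∑ k, |K k| := by
    intro x k
    have h1 : ∀ j ∈ Finset.univ, 0 ≤ (w j * Real.exp (ℓ j x) - c j * ℓ j x) + |K j| := by
      intro j _
      have := hK j (ℓ j x)
      have := mul_nonneg (hc j).le (abs_nonneg (ℓ j x))
      linarith [le_abs_self (K j)]
    have h2 := Finset.single_le_sum h1 (Finset.mem_univ k)
    rw [Finset.sum_add_distrib] at h2
    have := hK k (ℓ k x)
    simp only [hJ]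
    linarith [le_abs_self (K k), sq_nonneg (s x)]
  have hsterm : ∀ x, |s x| ≤ J x + ∑ k, |K k| + 1 := by
    intro x
    have h1 : 0 ≤ ∑ j, ((w j * Real.exp (ℓ j x) - c j * ℓ j x) + |K j|) := by
      refine Finset.sum_nonneg fun j _ => ?_
      have := hK j (ℓ j x)
      have := mul_nonneg (hc j).le (abs_nonneg (ℓ j x))
      linarith [le_abs_self (K j)]
    rw [Finset.sum_add_distrib] at h1
    simp only [hJ]
    nlinarith [sq_abs (s x), sq_nonneg (|s x| - 1)]
  have hcoer : ∃ x, ∀ y, J x ≤ J y := by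
    set L : E →L[ℝ] (ι → ℝ) × ℝ := (ContinuousLinearMap.pi ℓ).prod s with hL
    have hker : LinearMap.ker (L : E →ₗ[ℝ] (ι → ℝ) × ℝ) = ⊥ := by
      rw [LinearMap.ker_eq_bot']
      intro v hv
      have h1 : (ContinuousLinearMap.pi ℓ v, s v) = ((0 : ι → ℝ), (0 : ℝ)) := hv
      rw [Prod.mk.injEq] at h1
      exact hsep v (fun k => congrFun h1.1 k) h1.2
    obtain ⟨A, -, hA⟩ := LinearMap.exists_antilipschitzWith (L : E →ₗ[ℝ] (ι → ℝ) × ℝ) hker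
    refine hcont.exists_forall_le ?_
    have hnorm : Tendsto (fun x => ‖L x‖) (cocompact E) atTop :=
      tendsto_norm_cocompact_atTop.comp (AntilipschitzWith.isClosedEmbedding (f := L) hA L.uniformContinuous).tendsto_cocompact
    have hbound : ∀ x, ‖L x‖ ≤ ((∑ k, (c k)⁻¹) + 1) * (J x + ∑ k, |K k| + 1) := by
      intro x
      have hpos : 0 ≤ J x + ∑ k, |K k| + 1 := (abs_nonneg _).trans (hsterm x)
      have hcs : 0 ≤ ∑ k, (c k)⁻¹ := Finset.sum_nonneg fun k _ => (inv_pos.2 (hc k)).le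
      refine max_le ((pi_norm_le_iff_of_nonneg (by positivity)).2 fun k => ?_) ?_
      · have h1 : |ℓ k x| ≤ (c k)⁻¹ * (J x + ∑ k, |K k| + 1) := by
          rw [inv_mul_eq_div, le_div_iff₀ (hc k), mul_comm]
          linarith [hterm x k]
        refine h1.trans (mul_le_mul_of_nonneg_right ?_ hpos)
        have := Finset.single_le_sum (f := fun k => (c k)⁻¹)
          (fun k _ => (inv_pos.2 (hc k)).le) (Finset.mem_univ k)
        linarith
      · change |s x| ≤ _
        nlinarith [hsterm x, mul_nonneg hcs hpos]
    have hcs : 0 < (∑ k, (c k)⁻¹) + 1 :=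
      add_pos_of_nonneg_of_pos (Finset.sum_nonneg fun k _ => (inv_pos.2 (hc k)).le) one_pos
    have h1 := (tendsto_atTop_mono hbound hnorm).atTop_of_const_mul₀ hcs
    have h2 := tendsto_atTop_add_const_right _ (-(∑ k, |K k| + 1)) h1
    refine h2.congr fun x => ?_
    ring
  obtain ⟨x, hx⟩ := hcoer
  refine ⟨x, ContinuousLinearMap.ext fun v => ?_⟩
  have hline : ∀ f : E →L[ℝ] ℝ, HasDerivAt (fun t : ℝ => f (x + t • v)) (f v) 0 := by
    intro f
    have := ((hasDerivAt_id (0 : ℝ)).mul_const (f v)).const_add (f x)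
    simpa using this
  have hder : HasDerivAt (fun t : ℝ => J (x + t • v))
      (∑ k, (w k * (Real.exp (ℓ k (x + (0 : ℝ) • v)) * ℓ k v) - c k * ℓ k v)
        + (2 * s (x + (0 : ℝ) • v) ^ (2 - 1) * s v) / 2) 0 := by
    refine HasDerivAt.add (HasDerivAt.fun_sum fun k _ => ?_) (((hline s).pow 2).div_const 2)
    exact ((hline (ℓ k)).exp.const_mul (w k)).sub ((hline (ℓ k)).const_mul (c k))
  have hmin : IsLocalMin (fun t : ℝ => J (x + t • v)) 0 :=
    Eventually.of_forall fun t => by simpa using hx (x + t • v)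
  have h0 := hmin.hasDerivAt_eq_zero hder
  rw [expGradient_apply]
  simp only [zero_smul, add_zero, Finset.sum_sub_distrib] at h0
  simp only [sum_apply, smul_apply, smul_eq_mul,
    mul_assoc]
  norm_num at h0
  linarith

end ExpGradient

section Sinkhorn

variable {n m : ℕ}

/-- The functional `(α, β) ↦ α i + β j`. -/
def potentialSum (k : Fin n × Fin m) : ((Fin n → ℝ) × (Fin m → ℝ)) →L[ℝ] ℝ :=
  (ContinuousLinearMap.proj (R := ℝ) (φ := fun _ : Fin n => ℝ) k.1).comp
      (ContinuousLinearMap.fst ℝ _ _) +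
    (ContinuousLinearMap.proj (R := ℝ) (φ := fun _ : Fin m => ℝ) k.2).comp
      (ContinuousLinearMap.snd ℝ _ _)

/-- The functional `(α, β) ↦ ∑ i, α i - ∑ j, β j`, which fixes the gauge freedom
`(α + c, β - c)` of the dual potentials. -/
def potentialGap : ((Fin n → ℝ) × (Fin m → ℝ)) →L[ℝ] ℝ :=
  ∑ i, (ContinuousLinearMap.proj i).comp (ContinuousLinearMap.fst ℝ _ _) -
    ∑ j, (ContinuousLinearMap.proj j).comp (ContinuousLinearMap.snd ℝ _ _)

/-- The functional `(α, β) ↦ ⟨a, α⟩ + ⟨b, β⟩` for `p = (a, b)`. -/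
def marginalPairing (p : (Fin n → ℝ) × (Fin m → ℝ)) :
    ((Fin n → ℝ) × (Fin m → ℝ)) →L[ℝ] ℝ :=
  ∑ i, p.1 i • (ContinuousLinearMap.proj i).comp (ContinuousLinearMap.fst ℝ _ _) +
    ∑ j, p.2 j • (ContinuousLinearMap.proj j).comp (ContinuousLinearMap.snd ℝ _ _)

@[simp] lemma potentialSum_apply (k : Fin n × Fin m) (x : (Fin n → ℝ) × (Fin m → ℝ)) :
    potentialSum k x = x.1 k.1 + x.2 k.2 := rfl

@[simp] lemma potentialGap_apply (x : (Fin n → ℝ) × (Fin m → ℝ)) :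
    potentialGap x = ∑ i, x.1 i - ∑ j, x.2 j := by
  simp [potentialGap]

@[simp] lemma marginalPairing_apply (p x : (Fin n → ℝ) × (Fin m → ℝ)) :
    marginalPairing p x = ∑ i, p.1 i * x.1 i + ∑ j, p.2 j * x.2 j := by
  simp [marginalPairing]

lemma contDiff_marginalPairing :
    ContDiff ℝ ∞ (marginalPairing : (Fin n → ℝ) × (Fin m → ℝ) → _) := by
  unfold marginalPairing
  fun_prop

lemma eq_zero_of_potentialSum_eq_zero (hn : 1 ≤ n) (hm : 1 ≤ m)
    (v : (Fin n → ℝ) × (Fin m → ℝ)) (h : ∀ k, potentialSum k v = 0)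
    (hgap : potentialGap v = 0) : v = 0 := by
  have h1 : ∀ i, v.1 i = - v.2 ⟨0, hm⟩ := fun i => by
    have := h (i, ⟨0, hm⟩)
    simp only [potentialSum_apply] at this
    linarith
  have h2 : ∀ j, v.2 j = v.2 ⟨0, hm⟩ := fun j => by
    have := h (⟨0, hn⟩, j)
    simp only [potentialSum_apply, h1] at this
    linarith
  have h0 : v.2 ⟨0, hm⟩ = 0 := by
    rw [potentialGap_apply, Finset.sum_congr rfl fun i _ => h1 i,
      Finset.sum_congr rfl fun j _ => h2 j] at hgap
    simp only [Finset.sum_const, Finset.card_univ, Fintype.card_fin, nsmul_eq_mul] at hgap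
    have hn' : (1 : ℝ) ≤ n := by exact_mod_cast hn
    have hprod : ((n : ℝ) + m) * v.2 ⟨0, hm⟩ = 0 := by linarith
    exact (mul_eq_zero.1 hprod).resolve_left (by positivity)
  ext i
  · simp [h1, h0]
  · simp [h2 i, h0]

lemma sum_mul_potentialSum {T : Matrix (Fin n) (Fin m) ℝ} {p : (Fin n → ℝ) × (Fin m → ℝ)}
    (hrow : ∀ i, ∑ j, T i j = p.1 i) (hcol : ∀ j, ∑ i, T i j = p.2 j)
    (x : (Fin n → ℝ) × (Fin m → ℝ)) :
    ∑ i, ∑ j, T i j * (x.1 i + x.2 j) = marginalPairing p x := by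
  simp only [mul_add, Finset.sum_add_distrib, marginalPairing_apply]
  congr 1
  · simp only [← Finset.sum_mul, hrow]
  · rw [Finset.sum_comm]
    simp only [← Finset.sum_mul, hcol]

/-- The Gibbs plan with potentials `x = (α, β)`. -/
def gibbsPlan (M : Matrix (Fin n) (Fin m) ℝ) (lam : ℝ) (x : (Fin n → ℝ) × (Fin m → ℝ)) :
    Matrix (Fin n) (Fin m) ℝ :=
  fun i j => Real.exp (x.1 i + x.2 j - lam * M i j)

lemma gibbsPlan_mem_transportPolytope (hn : 1 ≤ n) {M : Matrix (Fin n) (Fin m) ℝ} {lam : ℝ}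
    {p x : (Fin n → ℝ) × (Fin m → ℝ)} (hp : p ∈ intSimplexPairs n m)
    (hx : expGradient (fun k : Fin n × Fin m => Real.exp (-(lam * M k.1 k.2)))
      potentialSum potentialGap x = marginalPairing p) :
    gibbsPlan M lam x ∈ transportPolytope p.1 p.2 := by
  have hv : ∀ v, ∑ i, ∑ j, gibbsPlan M lam x i j * (v.1 i + v.2 j)
      + potentialGap x * potentialGap v = marginalPairing p v := by
    intro v
    rw [← hx, expGradient_apply, Fintype.sum_prod_type]
    simp only [gibbsPlan, potentialSum_apply, ← Real.exp_add, sub_eq_neg_add]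
  have hrow : ∀ i, ∑ j, gibbsPlan M lam x i j + potentialGap x = p.1 i := by
    intro i
    have h := hv (Pi.single i 1, 0)
    simpa [-potentialGap_apply, potentialGap_apply (Pi.single i 1, 0), Pi.single_apply,
      ← Finset.sum_mul] using h
  have hcol : ∀ j, ∑ i, gibbsPlan M lam x i j - potentialGap x = p.2 j := by
    intro j
    have h := hv (0, Pi.single j 1)
    simpa [-potentialGap_apply, potentialGap_apply (0, Pi.single j 1), Pi.single_apply,
      sub_eq_add_neg] using h
  have hgap : potentialGap x = 0 := by
    have h1 := Finset.sum_congr rfl fun i (_ : i ∈ Finset.univ) => hrow i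
    have h2 := Finset.sum_congr rfl fun j (_ : j ∈ Finset.univ) => hcol j
    rw [Finset.sum_add_distrib, hp.2.1] at h1
    rw [Finset.sum_sub_distrib, hp.2.2.2, Finset.sum_comm] at h2
    simp only [Finset.sum_const, Finset.card_univ, Fintype.card_fin, nsmul_eq_mul] at h1 h2
    have hn' : (1 : ℝ) ≤ n := by exact_mod_cast hn
    have hprod : ((n : ℝ) + m) * potentialGap x = 0 := by linarith
    exact (mul_eq_zero.1 hprod).resolve_left (by positivity)
  refine ⟨fun i j => (Real.exp_pos _).le, fun i => ?_, fun j => ?_⟩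
  · simpa only [hgap, add_zero] using hrow i
  · simpa only [hgap, sub_zero] using hcol j

lemma mul_sub_exp_le_mul_log_sub_one {t : ℝ} (ht : 0 ≤ t) (y : ℝ) :
    t * y - Real.exp y ≤ t * (Real.log t - 1) := by
  rcases ht.eq_or_lt with rfl | ht
  · simpa using (Real.exp_pos y).le
  · have h : Real.exp y = t * Real.exp (y - Real.log t) := by
      rw [Real.exp_sub, Real.exp_log ht]
      field_simp
    nlinarith [mul_le_mul_of_nonneg_left (Real.add_one_le_exp (y - Real.log t)) ht.le]

/-- A Gibbs plan that lies in the transportation polytope minimizes the regularized cost. -/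
lemma sInf_regularizedCost_eq {M : Matrix (Fin n) (Fin m) ℝ} {lam : ℝ} (hlam : 0 < lam)
    {p x : (Fin n → ℝ) × (Fin m → ℝ)} (hp : ∑ i, p.1 i = 1)
    (hx : gibbsPlan M lam x ∈ transportPolytope p.1 p.2) :
    sInf ((fun T => frob T M - ent T / lam) '' transportPolytope p.1 p.2) =
      (marginalPairing p x - 1) / lam := by
  have hcost : ∀ T : Matrix (Fin n) (Fin m) ℝ, frob T M - ent T / lam =
      (∑ i, ∑ j, (T i j * (lam * M i j) + T i j * (Real.log (T i j) - 1))) / lam := by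
    intro T
    simp only [frob, ent, Finset.sum_add_distrib, mul_left_comm _ lam, ← Finset.mul_sum]
    field_simp
    ring
  have hmass : ∑ i, ∑ j, gibbsPlan M lam x i j = 1 := by
    rw [Finset.sum_congr rfl fun i _ => hx.2.1 i, hp]
  have hval : ∀ T ∈ transportPolytope p.1 p.2, marginalPairing p x - 1 =
      ∑ i, ∑ j, (T i j * (x.1 i + x.2 j) - gibbsPlan M lam x i j) := by
    intro T hT
    simp only [Finset.sum_sub_distrib, hmass, sum_mul_potentialSum hT.2.1 hT.2.2]
  refine IsLeast.csInf_eq ⟨⟨_, hx, ?_⟩, ?_⟩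
  · simp only [hcost]
    rw [hval _ hx]
    congr 1
    refine Finset.sum_congr rfl fun i _ => Finset.sum_congr rfl fun j _ => ?_
    simp only [gibbsPlan, Real.log_exp]
    ring
  · rintro _ ⟨T, hT, rfl⟩
    simp only [hcost]
    rw [hval T hT]
    refine div_le_div_of_nonneg_right ?_ hlam.le
    refine Finset.sum_le_sum fun i _ => Finset.sum_le_sum fun j _ => ?_
    have := mul_sub_exp_le_mul_log_sub_one (hT.1 i j) (x.1 i + x.2 j - lam * M i j)
    simp only [gibbsPlan]
    linarith

end Sinkhorn

/-- for every `λ > 0`, the regularized Sinkhorn distance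
`S̃_λ(a,b) = min_{T ∈ Π(a,b)} ⟨T,M⟩ - h(T)/λ` is `C^∞` on the interior of `Δ_n × Δ_m`
(smoothness along the affine subspace, expressed via `ContDiffOn`). -/
theorem statement5 {n m : ℕ} (hn : 1 ≤ n) (hm : 1 ≤ m)
    (M : Matrix (Fin n) (Fin m) ℝ) (lam : ℝ) (hlam : 0 < lam) :
    ContDiffOn ℝ (⊤ : ℕ∞)
      (fun p : (Fin n → ℝ) × (Fin m → ℝ) =>
        sInf ((fun T => frob T M - ent T / lam) '' transportPolytope p.1 p.2))
      (intSimplexPairs n m) := by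
  intro p hp
  have hw : ∀ k : Fin n × Fin m, 0 < Real.exp (-(lam * M k.1 k.2)) := fun k => Real.exp_pos _
  have hsep := eq_zero_of_potentialSum_eq_zero hn hm
  obtain ⟨x, hx⟩ := exists_expGradient_eq (c := fun k : Fin n × Fin m => p.1 k.1 * p.2 k.2)
    hw (fun k => mul_pos (hp.1 k.1) (hp.2.2.1 k.2)) hsep
  have hprod : ∑ k : Fin n × Fin m, (p.1 k.1 * p.2 k.2) • potentialSum k =
      marginalPairing p := by
    refine ContinuousLinearMap.ext fun v => ?_
    rw [← sum_mul_potentialSum (T := fun i j => p.1 i * p.2 j)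
      (fun i => by rw [← Finset.mul_sum, hp.2.2.2, mul_one])
      (fun j => by rw [← Finset.sum_mul, hp.2.1, one_mul]) v]
    simp [Fintype.sum_prod_type]
  obtain ⟨g, hg, hGg⟩ := exists_contDiffAt_rightInverse_expGradient hw hsep x
  rw [hx, hprod] at hg hGg
  have hpair : ContDiffAt ℝ ∞ (marginalPairing : (Fin n → ℝ) × (Fin m → ℝ) → _) p :=
    contDiff_marginalPairing.contDiffAt
  have hsmooth : ContDiffAt ℝ ∞
      (fun q => (marginalPairing q (g (marginalPairing q)) - 1) / lam) p :=
    ((hpair.clm_apply (hg.comp p hpair)).sub contDiffAt_const).div_const lam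
  have heq : ∀ q ∈ intSimplexPairs n m,
      expGradient (fun k : Fin n × Fin m => Real.exp (-(lam * M k.1 k.2)))
        potentialSum potentialGap (g (marginalPairing q)) = marginalPairing q →
      sInf ((fun T => frob T M - ent T / lam) '' transportPolytope q.1 q.2) =
        (marginalPairing q (g (marginalPairing q)) - 1) / lam := fun q hq h =>
    sInf_regularizedCost_eq hlam hq.2.1 (gibbsPlan_mem_transportPolytope hn hq h)
  refine hsmooth.contDiffWithinAt.congr_of_eventuallyEq ?_
    (heq p hp hGg.self_of_nhds)
  filter_upwards [self_mem_nhdsWithin,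
    mem_nhdsWithin_of_mem_nhds (hpair.continuousAt.eventually hGg)] with q hq h
  exact heq q hq h
end
end

section
/- For a in the interior of Δ_n and b in the interior of Δ_m, the reduced dual function 𝓛_{a,b} is C^∞ and strictly convex on ℝ^n × ℝ^{m-1}, and its Hessian is positive definite (hence invertible) at every point. -/
open scoped BigOperators

noncomputable section

/-- Extend `β ∈ ℝ^{m-1}` to `ℝ^m` (here `m = k+1`) by the convention `β_m = 0`. -/
def betaExt {k : ℕ} (β : Fin k → ℝ) : Fin (k + 1) → ℝ := Fin.snoc β 0

/-- The reduced dual function `𝓛_{a,b}(α,β) = -αᵀa - βᵀb̄ + λ⁻¹ ∑_{ij} e^{-λ(M_ij - α_i - β_j)}`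
of entropic optimal transport, as a function of the combined dual variable
`γ = (α, β) ∈ ℝ^n × ℝ^{m-1}` (here `m = k+1`, `b̄` is `b` with last entry removed, `β_m = 0`). -/
def dualL {n k : ℕ} (M : Matrix (Fin n) (Fin (k + 1)) ℝ) (lam : ℝ)
    (a : Fin n → ℝ) (b : Fin (k + 1) → ℝ) (γ : Fin n ⊕ Fin k → ℝ) : ℝ :=
  -(∑ i, γ (Sum.inl i) * a i) - (∑ j : Fin k, γ (Sum.inr j) * b j.castSucc)
    + lam⁻¹ * ∑ i, ∑ j,
        Real.exp (-(lam * (M i j - γ (Sum.inl i) - betaExt (fun j' => γ (Sum.inr j')) j)))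

/-- The Hessian matrix (matrix of second partial derivatives) of a function of
`γ : Fin n ⊕ Fin k → ℝ` at a point `x`. -/
def hessMatrix {n k : ℕ} (f : ((Fin n ⊕ Fin k) → ℝ) → ℝ) (x : (Fin n ⊕ Fin k) → ℝ) :
    Matrix (Fin n ⊕ Fin k) (Fin n ⊕ Fin k) ℝ :=
  Matrix.of fun p q => fderiv ℝ (fun y => fderiv ℝ f y (Pi.single q 1)) x (Pi.single p 1)

section ExpSum

variable {E ι : Type*} [NormedAddCommGroup E] [NormedSpace ℝ E] [Fintype ι]

/-- A linear form plus a multiple of a sum of exponentials of affine forms. -/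
def affineExpSum (L : E →L[ℝ] ℝ) (c : ℝ) (ℓ : ι → E →L[ℝ] ℝ) (d : ι → ℝ) (x : E) : ℝ :=
  L x + c * ∑ s, Real.exp (ℓ s x + d s)

theorem contDiff_affineExpSum (L : E →L[ℝ] ℝ) (c : ℝ) (ℓ : ι → E →L[ℝ] ℝ) (d : ι → ℝ) :
    ContDiff ℝ (⊤ : ℕ∞) (affineExpSum L c ℓ d) := by
  unfold affineExpSum
  fun_prop

theorem hasFDerivAt_exp_affine (ℓ : E →L[ℝ] ℝ) (d : ℝ) (x : E) :
    HasFDerivAt (fun y => Real.exp (ℓ y + d)) (Real.exp (ℓ x + d) • ℓ) x :=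
  (ℓ.hasFDerivAt.add_const d).exp

theorem fderiv_affineExpSum_apply (L : E →L[ℝ] ℝ) (c : ℝ) (ℓ : ι → E →L[ℝ] ℝ) (d : ι → ℝ)
    (x v : E) :
    fderiv ℝ (affineExpSum L c ℓ d) x v = L v + c * ∑ s, Real.exp (ℓ s x + d s) * ℓ s v := by
  have h : HasFDerivAt (affineExpSum L c ℓ d)
      (L + c • ∑ s, Real.exp (ℓ s x + d s) • ℓ s) x :=
    L.hasFDerivAt.add
      ((HasFDerivAt.fun_sum fun s _ => hasFDerivAt_exp_affine (ℓ s) (d s) x).const_mul c)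
  simp [h.fderiv]

theorem fderiv_fderiv_affineExpSum_apply (L : E →L[ℝ] ℝ) (c : ℝ) (ℓ : ι → E →L[ℝ] ℝ)
    (d : ι → ℝ) (x u v : E) :
    fderiv ℝ (fun y => fderiv ℝ (affineExpSum L c ℓ d) y v) x u =
      c * ∑ s, Real.exp (ℓ s x + d s) * ℓ s u * ℓ s v := by
  simp only [fderiv_affineExpSum_apply]
  have h : HasFDerivAt (fun y => L v + c * ∑ s, Real.exp (ℓ s y + d s) * ℓ s v)
      (c • ∑ s, ℓ s v • Real.exp (ℓ s x + d s) • ℓ s) x :=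
    ((HasFDerivAt.fun_sum fun s _ =>
      (hasFDerivAt_exp_affine (ℓ s) (d s) x).mul_const (ℓ s v)).const_mul c).const_add (L v)
  rw [h.fderiv]
  simp [mul_comm]

theorem strictConvexOn_affineExpSum (L : E →L[ℝ] ℝ) {c : ℝ} (hc : 0 < c)
    {ℓ : ι → E →L[ℝ] ℝ} (hℓ : ∀ v, (∀ s, ℓ s v = 0) → v = 0) (d : ι → ℝ) :
    StrictConvexOn ℝ Set.univ (affineExpSum L c ℓ d) := by
  refine ⟨convex_univ, fun x _ y _ hxy t u ht hu htu => ?_⟩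
  have harg (s : ι) :
      ℓ s (t • x + u • y) + d s = t • (ℓ s x + d s) + u • (ℓ s y + d s) := by
    simp only [map_add, map_smul, smul_eq_mul]
    linear_combination (-d s) * htu
  have hlt : ∑ s, Real.exp (ℓ s (t • x + u • y) + d s) <
      ∑ s, (t • Real.exp (ℓ s x + d s) + u • Real.exp (ℓ s y + d s)) := by
    obtain ⟨s, hs⟩ : ∃ s, ℓ s (x - y) ≠ 0 := by
      by_contra! h
      exact hxy (sub_eq_zero.mp (hℓ _ h))
    refine Finset.sum_lt_sum (fun r _ => ?_) ⟨s, Finset.mem_univ s, ?_⟩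
    · rw [harg]
      exact convexOn_exp.2 trivial trivial ht.le hu.le htu
    · rw [harg]
      refine strictConvexOn_exp.2 trivial trivial (fun h => hs ?_) ht hu htu
      rw [map_sub]
      linarith
  have hmul := mul_lt_mul_of_pos_left hlt hc
  rw [Finset.sum_add_distrib, ← Finset.smul_sum, ← Finset.smul_sum] at hmul
  simp only [affineExpSum, map_add, map_smul, smul_eq_mul] at hmul ⊢
  linarith

end ExpSum

theorem posDef_hessMatrix_affineExpSum {n k : ℕ} {ι : Type*} [Fintype ι]
    (L : (Fin n ⊕ Fin k → ℝ) →L[ℝ] ℝ) {c : ℝ} (hc : 0 < c)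
    {ℓ : ι → (Fin n ⊕ Fin k → ℝ) →L[ℝ] ℝ} (hℓ : ∀ v, (∀ s, ℓ s v = 0) → v = 0)
    (d : ι → ℝ) (x : Fin n ⊕ Fin k → ℝ) :
    (hessMatrix (affineExpSum L c ℓ d) x).PosDef := by
  let A : Matrix ι (Fin n ⊕ Fin k) ℝ :=
    Matrix.of fun s p => √(c * Real.exp (ℓ s x + d s)) * ℓ s (Pi.single p 1)
  have hpos (s : ι) : 0 < c * Real.exp (ℓ s x + d s) := by positivity
  have hA : hessMatrix (affineExpSum L c ℓ d) x = A.conjTranspose * A := by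
    ext p q
    simp only [hessMatrix, Matrix.of_apply, fderiv_fderiv_affineExpSum_apply, Matrix.mul_apply,
      Matrix.conjTranspose_apply, A, star_trivial, Finset.mul_sum]
    refine Finset.sum_congr rfl fun s _ => ?_
    linear_combination (-(ℓ s (Pi.single p 1) * ℓ s (Pi.single q 1))) *
      Real.mul_self_sqrt (hpos s).le
  have hmulVec (v : Fin n ⊕ Fin k → ℝ) (s : ι) :
      A.mulVec v s = √(c * Real.exp (ℓ s x + d s)) * ℓ s v := by
    have hv : v = ∑ p, v p • Pi.single p (1 : ℝ) := by
      simp [← Pi.single_smul, Finset.univ_sum_single]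
    conv_rhs => rw [hv]
    simp only [Matrix.mulVec, dotProduct, A, Matrix.of_apply, map_sum, map_smul, smul_eq_mul,
      Finset.mul_sum]
    refine Finset.sum_congr rfl fun p _ => ?_
    ring
  rw [hA]
  refine Matrix.PosDef.conjTranspose_mul_self A ?_
  refine (injective_iff_map_eq_zero A.mulVecLin).2 fun v hv => hℓ v fun s => ?_
  have hs := congrFun hv s
  rw [Matrix.mulVecLin_apply, hmulVec] at hs
  exact (mul_eq_zero.mp hs).resolve_left (Real.sqrt_pos.2 (hpos s)).ne'

/-- The linear form `γ = (α, β) ↦ λ (α_i + β_j)`, with `β_m = 0`. -/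
def dualForm {n k : ℕ} (lam : ℝ) (s : Fin n × Fin (k + 1)) : (Fin n ⊕ Fin k → ℝ) →L[ℝ] ℝ :=
  lam • (ContinuousLinearMap.proj (Sum.inl s.1) +
    Fin.lastCases (motive := fun _ => (Fin n ⊕ Fin k → ℝ) →L[ℝ] ℝ) 0
      (fun j => ContinuousLinearMap.proj (Sum.inr j)) s.2)

theorem dualForm_apply {n k : ℕ} (lam : ℝ) (s : Fin n × Fin (k + 1)) (γ : Fin n ⊕ Fin k → ℝ) :
    dualForm lam s γ = lam * (γ (Sum.inl s.1) + betaExt (fun j => γ (Sum.inr j)) s.2) := by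
  obtain ⟨i, j⟩ := s
  cases j using Fin.lastCases <;> simp [dualForm, betaExt, mul_add]

theorem eq_zero_of_dualForm_eq_zero {n k : ℕ} (hn : 1 ≤ n) {lam : ℝ} (hlam : 0 < lam)
    (γ : Fin n ⊕ Fin k → ℝ) (h : ∀ s, dualForm lam s γ = 0) : γ = 0 := by
  have hsum (i : Fin n) (j : Fin (k + 1)) :
      γ (Sum.inl i) + betaExt (fun j => γ (Sum.inr j)) j = 0 := by
    simpa [dualForm_apply, hlam.ne'] using h (i, j)
  have hα (i : Fin n) : γ (Sum.inl i) = 0 := by simpa [betaExt] using hsum i (Fin.last k)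
  ext (i | j)
  · exact hα i
  · simpa [betaExt, hα] using hsum ⟨0, hn⟩ j.castSucc

theorem dualL_eq_affineExpSum {n k : ℕ} (M : Matrix (Fin n) (Fin (k + 1)) ℝ) (lam : ℝ)
    (a : Fin n → ℝ) (b : Fin (k + 1) → ℝ) :
    dualL M lam a b = affineExpSum
      (-(∑ i, a i • ContinuousLinearMap.proj (Sum.inl i)) -
        ∑ j : Fin k, b j.castSucc • ContinuousLinearMap.proj (Sum.inr j))
      lam⁻¹ (dualForm lam) (fun s => -(lam * M s.1 s.2)) := by
  ext γ
  simp only [dualL, affineExpSum, dualForm_apply, Fintype.sum_prod_type]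
  congr 1
  · simp [mul_comm]
  · congr! 4
    ring

/-- for `a` in the interior of `Δ_n` and `b` in the interior of `Δ_m`
(`m = k+1 ≥ 2`), the reduced dual function `𝓛_{a,b}` is `C^∞` and strictly convex on
`ℝ^n × ℝ^{m-1}`, and its Hessian is positive definite (hence invertible) at every point. -/
theorem statement8 {n k : ℕ} (hn : 1 ≤ n) (hk : 1 ≤ k)
    (M : Matrix (Fin n) (Fin (k + 1)) ℝ) (lam : ℝ) (hlam : 0 < lam)
    (a : Fin n → ℝ) (ha : a ∈ stdSimplex ℝ (Fin n)) (ha' : ∀ i, 0 < a i)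
    (b : Fin (k + 1) → ℝ) (hb : b ∈ stdSimplex ℝ (Fin (k + 1))) (hb' : ∀ j, 0 < b j) :
    ContDiff ℝ (⊤ : ℕ∞) (dualL M lam a b) ∧
    StrictConvexOn ℝ Set.univ (dualL M lam a b) ∧
    ∀ γ : (Fin n ⊕ Fin k) → ℝ,
      (hessMatrix (dualL M lam a b) γ).PosDef ∧
      IsUnit (hessMatrix (dualL M lam a b) γ).det := by
  have hℓ := eq_zero_of_dualForm_eq_zero (n := n) (k := k) hn hlam
  rw [dualL_eq_affineExpSum]
  refine ⟨contDiff_affineExpSum _ _ _ _,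
    strictConvexOn_affineExpSum _ (inv_pos.2 hlam) hℓ _, fun γ => ?_⟩
  suffices hpd : (hessMatrix _ γ).PosDef from ⟨hpd, hpd.det_pos.ne'.isUnit⟩
  exact posDef_hessMatrix_affineExpSum _ (inv_pos.2 hlam) hℓ _ γ
end
end

section
/- For a in the interior of Δ_n and b in the interior of Δ_m, the reduced dual function 𝓛_{a,b} attains its global minimum at a unique point (α*(a,b), β*(a,b)) ∈ ℝ^n × ℝ^{m-1}. -/
open scoped BigOperators

noncomputable section

/-- The function `t ↦ -c t + d e^{l t}` grows at least linearly in `|t|`. -/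
lemma exists_mul_abs_sub_le_neg_mul_add_exp {c d l : ℝ} (hc : 0 < c) (hd : 0 < d) (hl : 0 < l) :
    ∃ K : ℝ, ∀ t, c * |t| - K ≤ -(c * t) + d * Real.exp (l * t) := by
  have hx : 0 < d * l / (2 * c) := by positivity
  refine ⟨|2 * c / l * (1 + Real.log (d * l / (2 * c)))|, fun t => ?_⟩
  have hexp : 2 * c / l * (l * t + Real.log (d * l / (2 * c)) + 1) ≤ d * Real.exp (l * t) := by
    calc _ ≤ 2 * c / l * Real.exp (l * t + Real.log (d * l / (2 * c))) := by
            gcongr; exact Real.add_one_le_exp _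
      _ = d * Real.exp (l * t) := by
            rw [Real.exp_add, Real.exp_log hx]; field_simp
  have hsplit : 2 * c / l * (l * t + Real.log (d * l / (2 * c)) + 1)
      = 2 * (c * t) + 2 * c / l * (1 + Real.log (d * l / (2 * c))) := by
    field_simp; ring
  have hpos : 0 < d * Real.exp (l * t) := by positivity
  rcases abs_cases t with ⟨h, -⟩ | ⟨h, -⟩ <;> rw [h]
  · linarith [neg_abs_le (2 * c / l * (1 + Real.log (d * l / (2 * c))))]
  · linarith [abs_nonneg (2 * c / l * (1 + Real.log (d * l / (2 * c))))]

lemma strictConvexOn_neg_mul_add_exp (c : ℝ) {d l : ℝ} (hd : 0 < d) (hl : 0 < l) :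
    StrictConvexOn ℝ Set.univ fun t : ℝ => -(c * t) + d * Real.exp (l * t) := by
  refine ⟨convex_univ, fun x _ y _ hxy r s hr hs hrs => ?_⟩
  have h := strictConvexOn_exp.2 (Set.mem_univ (l * x)) (Set.mem_univ (l * y))
    (fun h => hxy (mul_left_cancel₀ hl.ne' h)) hr hs hrs
  simp only [smul_eq_mul] at h ⊢
  rw [show r * (l * x) + s * (l * y) = l * (r * x + s * y) by ring] at h
  linarith [mul_lt_mul_of_pos_left h hd]

/-- A separable sum of strictly convex functions, precomposed with an injective linear map,
is strictly convex. -/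
lemma strictConvexOn_sum_comp_linearMap {E ι : Type*} [AddCommGroup E] [Module ℝ E] [Fintype ι]
    {f : ι → ℝ → ℝ} (hf : ∀ p, StrictConvexOn ℝ Set.univ (f p))
    (A : E →ₗ[ℝ] ι → ℝ) (hA : Function.Injective A) :
    StrictConvexOn ℝ Set.univ fun x => ∑ p, f p (A x p) := by
  refine ⟨convex_univ, fun x _ y _ hxy r s hr hs hrs => ?_⟩
  obtain ⟨q, hq⟩ := Function.ne_iff.mp (hA.ne hxy)
  simp only [map_add, map_smul, Pi.add_apply, Pi.smul_apply, Finset.smul_sum,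
    ← Finset.sum_add_distrib]
  exact Finset.sum_lt_sum
    (fun p _ => (hf p).convexOn.2 (Set.mem_univ _) (Set.mem_univ _) hr.le hs.le hrs)
    ⟨q, Finset.mem_univ q, (hf q).2 (Set.mem_univ _) (Set.mem_univ _) hq hr hs hrs⟩

/-- A separable sum of functions growing at least linearly is coercive. -/
lemma tendsto_sum_cocompact_atTop {ι : Type*} [Fintype ι] {f : ι → ℝ → ℝ}
    (hf : ∀ p, ∃ c > 0, ∃ K : ℝ, ∀ t, c * |t| - K ≤ f p t) :
    Filter.Tendsto (fun u : ι → ℝ => ∑ p, f p (u p)) (Filter.cocompact _) Filter.atTop := by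
  choose c hc K hK using hf
  obtain ⟨e, he, hec⟩ : ∃ e > 0, ∀ p, e ≤ c p := by
    cases isEmpty_or_nonempty ι
    · exact ⟨1, one_pos, fun p => isEmptyElim p⟩
    · obtain ⟨p, hp⟩ := Finite.exists_min c
      exact ⟨c p, hc p, hp⟩
  refine Filter.tendsto_atTop_mono (fun u => ?_) (Filter.tendsto_atTop_add_const_right _ (-∑ p, K p)
    ((tendsto_norm_cocompact_atTop (E := ι → ℝ)).const_mul_atTop he))
  have hnorm : ‖u‖ ≤ ∑ p, |u p| :=
    (pi_norm_le_iff_of_nonneg (by positivity)).2 fun p =>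
      Finset.single_le_sum (f := fun p => |u p|) (fun _ _ => abs_nonneg _) (Finset.mem_univ p)
  calc e * ‖u‖ + -∑ p, K p ≤ e * ∑ p, |u p| - ∑ p, K p := by
        rw [← sub_eq_add_neg]; gcongr
    _ = ∑ p, (e * |u p| - K p) := by rw [Finset.mul_sum, Finset.sum_sub_distrib]
    _ ≤ ∑ p, f p (u p) := Finset.sum_le_sum fun p _ =>
        (sub_le_sub_right (mul_le_mul_of_nonneg_right (hec p) (abs_nonneg _)) _).trans (hK p _)

lemma existsUnique_isMinOn_sum_neg_mul_add_exp {E ι : Type*} [NormedAddCommGroup E]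
    [NormedSpace ℝ E] [FiniteDimensional ℝ E] [Fintype ι] {c d : ι → ℝ} {l : ℝ}
    (hc : ∀ p, 0 < c p) (hd : ∀ p, 0 < d p) (hl : 0 < l)
    (A : E →ₗ[ℝ] ι → ℝ) (hA : Function.Injective A) :
    ∃! x : E, IsMinOn (fun x => ∑ p, (-(c p * A x p) + d p * Real.exp (l * A x p)))
      Set.univ x := by
  have hAc : Continuous A := A.continuous_of_finiteDimensional
  have hcoer := (tendsto_sum_cocompact_atTop (f := fun p t => -(c p * t) + d p * Real.exp (l * t))
    fun p => ⟨c p, hc p, exists_mul_abs_sub_le_neg_mul_add_exp (hc p) (hd p) hl⟩).comp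
      (LinearMap.isClosedEmbedding_of_injective (LinearMap.ker_eq_bot.2 hA)).tendsto_cocompact
  obtain ⟨x, hx⟩ := Continuous.exists_forall_le (by fun_prop) hcoer
  have hmin : IsMinOn (fun x => ∑ p, (-(c p * A x p) + d p * Real.exp (l * A x p)))
      Set.univ x := fun y _ => hx y
  exact ⟨x, hmin, fun y hy =>
    (strictConvexOn_sum_comp_linearMap
      (fun p => strictConvexOn_neg_mul_add_exp (c p) (hd p) hl) A hA).eq_of_isMinOn
        hy hmin (Set.mem_univ _) (Set.mem_univ _)⟩

@[simp] lemma betaExt_castSucc {k : ℕ} (β : Fin k → ℝ) (j : Fin k) :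
    betaExt β j.castSucc = β j := by simp [betaExt]

@[simp] lemma betaExt_last {k : ℕ} (β : Fin k → ℝ) : betaExt β (Fin.last k) = 0 := by
  simp [betaExt]

/-- The linear map `(α, β) ↦ (α_i + β_j)_{ij}`, with `β_m = 0`. -/
def dualSum (n k : ℕ) : (Fin n ⊕ Fin k → ℝ) →ₗ[ℝ] Fin n × Fin (k + 1) → ℝ where
  toFun γ p := γ (Sum.inl p.1) + betaExt (fun j => γ (Sum.inr j)) p.2
  map_add' x y := by
    ext ⟨i, j⟩
    induction j using Fin.lastCases with
    | last => simp
    | cast j => simp; ring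
  map_smul' r x := by
    ext ⟨i, j⟩
    induction j using Fin.lastCases with
    | last => simp
    | cast j => simp; ring

lemma dualSum_apply {n k : ℕ} (γ : Fin n ⊕ Fin k → ℝ) (p : Fin n × Fin (k + 1)) :
    dualSum n k γ p = γ (Sum.inl p.1) + betaExt (fun j => γ (Sum.inr j)) p.2 := rfl

lemma dualSum_injective {n k : ℕ} (hn : 1 ≤ n) : Function.Injective (dualSum n k) := by
  intro x y h
  have hl (i : Fin n) : x (Sum.inl i) = y (Sum.inl i) := by
    simpa [dualSum_apply] using congrFun h (i, Fin.last k)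
  ext (i | j)
  · exact hl i
  · simpa [dualSum_apply, hl] using congrFun h (⟨0, hn⟩, j.castSucc)

lemma dualL_eq_sum {n k : ℕ} (M : Matrix (Fin n) (Fin (k + 1)) ℝ) (lam : ℝ)
    {a : Fin n → ℝ} (ha : ∑ i, a i = 1) {b : Fin (k + 1) → ℝ} (hb : ∑ j, b j = 1) :
    dualL M lam a b = fun γ => ∑ p : Fin n × Fin (k + 1), (-(a p.1 * b p.2 * dualSum n k γ p)
      + lam⁻¹ * Real.exp (-(lam * M p.1 p.2)) * Real.exp (lam * dualSum n k γ p)) := by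
  funext γ
  have hlin : ∑ p : Fin n × Fin (k + 1), a p.1 * b p.2 * dualSum n k γ p
      = (∑ i, γ (Sum.inl i) * a i) + ∑ j : Fin k, γ (Sum.inr j) * b j.castSucc := by
    have hβ : ∑ j, betaExt (fun j => γ (Sum.inr j)) j * b j
        = ∑ j : Fin k, γ (Sum.inr j) * b j.castSucc := by
      simp [Fin.sum_univ_castSucc]
    calc _ = ∑ i, ∑ j, (γ (Sum.inl i) * a i * b j
              + a i * (betaExt (fun j => γ (Sum.inr j)) j * b j)) := by
          rw [Fintype.sum_prod_type]
          refine Finset.sum_congr rfl fun i _ => Finset.sum_congr rfl fun j _ => ?_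
          rw [dualSum_apply]; ring
      _ = _ := by
          simp only [Finset.sum_add_distrib, ← Finset.mul_sum, ← Finset.sum_mul, ha, hb, hβ,
            mul_one, one_mul]
  rw [Finset.sum_add_distrib, Finset.sum_neg_distrib, hlin, dualL, Fintype.sum_prod_type,
    Finset.mul_sum, neg_add, ← sub_eq_add_neg]
  congr 1
  refine Finset.sum_congr rfl fun i _ => ?_
  rw [Finset.mul_sum]
  refine Finset.sum_congr rfl fun j _ => ?_
  rw [mul_assoc, ← Real.exp_add, dualSum_apply]
  ring_nf

/-- for `a` in the interior of `Δ_n` and `b` in the interior of `Δ_m`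
(`m = k+1 ≥ 2`), the reduced dual function `𝓛_{a,b}` attains its global minimum at a
unique point `(α*(a,b), β*(a,b)) ∈ ℝ^n × ℝ^{m-1}`. -/
theorem statement9 {n k : ℕ} (hn : 1 ≤ n) (hk : 1 ≤ k)
    (M : Matrix (Fin n) (Fin (k + 1)) ℝ) (lam : ℝ) (hlam : 0 < lam)
    (a : Fin n → ℝ) (ha : a ∈ stdSimplex ℝ (Fin n)) (ha' : ∀ i, 0 < a i)
    (b : Fin (k + 1) → ℝ) (hb : b ∈ stdSimplex ℝ (Fin (k + 1))) (hb' : ∀ j, 0 < b j) :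
    ∃! γ : (Fin n ⊕ Fin k) → ℝ, IsMinOn (dualL M lam a b) Set.univ γ := by
  rw [dualL_eq_sum M lam ha.2 hb.2]
  exact existsUnique_isMinOn_sum_neg_mul_add_exp
    (c := fun p : Fin n × Fin (k + 1) => a p.1 * b p.2)
    (d := fun p => lam⁻¹ * Real.exp (-(lam * M p.1 p.2)))
    (fun p => mul_pos (ha' p.1) (hb' p.2)) (fun p => by positivity) hlam
    (dualSum n k) (dualSum_injective hn)
end
end

section
/- The map (a,b) ↦ (α*(a,b), β*(a,b)) sending a pair of marginals in the interior of Δ_n × Δ_m to the unique minimizer of the reduced dual function 𝓛_{a,b} is infinitely differentiable (C^∞) on the interior of Δ_n × Δ_m. -/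
open scoped BigOperators

noncomputable section

section ExpPotential

variable {ι κ : Type*} [Fintype ι] [Fintype κ] [DecidableEq κ]

/-- The gradient of `γ ↦ lam⁻¹ * ∑ i, exp (c i + lam * z i γ)`. -/
def expGrad (c : ι → ℝ) (lam : ℝ) (z : ι → (κ → ℝ) →L[ℝ] ℝ) (γ : κ → ℝ) : κ → ℝ :=
  ∑ i, Real.exp (c i + lam * z i γ) • fun p => z i (Pi.single p 1)

theorem sum_mul_apply_single (f : (κ → ℝ) →L[ℝ] ℝ) (d : κ → ℝ) :
    ∑ p, d p * f (Pi.single p 1) = f d := by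
  conv_rhs => rw [pi_eq_sum_univ' d, map_sum]
  refine Finset.sum_congr rfl fun p _ => ?_
  rw [map_smul, smul_eq_mul]

theorem sum_mul_expGrad (c : ι → ℝ) (lam : ℝ) (z : ι → (κ → ℝ) →L[ℝ] ℝ) (γ d : κ → ℝ) :
    ∑ p, d p * expGrad c lam z γ p = ∑ i, Real.exp (c i + lam * z i γ) * z i d := by
  simp only [expGrad, Finset.sum_apply, Pi.smul_apply, smul_eq_mul, Finset.mul_sum]
  rw [Finset.sum_comm]
  refine Finset.sum_congr rfl fun i _ => ?_
  rw [← sum_mul_apply_single (z i) d, Finset.mul_sum]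
  exact Finset.sum_congr rfl fun p _ => by ring

theorem contDiff_expGrad (c : ι → ℝ) (lam : ℝ) (z : ι → (κ → ℝ) →L[ℝ] ℝ)
    {r : WithTop ℕ∞} : ContDiff ℝ r (expGrad c lam z) := by
  unfold expGrad
  fun_prop

theorem hasFDerivAt_expGrad (c : ι → ℝ) (lam : ℝ) (z : ι → (κ → ℝ) →L[ℝ] ℝ) (γ : κ → ℝ) :
    HasFDerivAt (expGrad c lam z)
      (∑ i, (Real.exp (c i + lam * z i γ) • lam • z i).smulRight
        (fun p => z i (Pi.single p 1))) γ := by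
  unfold expGrad
  refine HasFDerivAt.fun_sum fun i _ => ?_
  exact ((((z i).hasFDerivAt.const_mul lam).const_add (c i)).exp).smul_const _

theorem expGrad_injective (c : ι → ℝ) {lam : ℝ} (hlam : 0 < lam) {z : ι → (κ → ℝ) →L[ℝ] ℝ}
    (hz : ∀ d, (∀ i, z i d = 0) → d = 0) : Function.Injective (expGrad c lam z) := by
  intro x y hxy
  have hterm : ∀ i, 0 ≤ Real.exp (c i + lam * z i x) * z i (x - y)
      - Real.exp (c i + lam * z i y) * z i (x - y) := by
    intro i
    rw [← sub_mul, map_sub]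
    rcases le_total (z i x) (z i y) with h | h
    · refine mul_nonneg_of_nonpos_of_nonpos (sub_nonpos.2 (Real.exp_le_exp.2 ?_)) (by linarith)
      gcongr
    · refine mul_nonneg (sub_nonneg.2 (Real.exp_le_exp.2 ?_)) (by linarith)
      gcongr
  have hsum : ∑ i, (Real.exp (c i + lam * z i x) * z i (x - y)
      - Real.exp (c i + lam * z i y) * z i (x - y)) = 0 := by
    rw [Finset.sum_sub_distrib, ← sum_mul_expGrad, ← sum_mul_expGrad, hxy, sub_self]
  refine sub_eq_zero.1 (hz _ fun i => ?_)
  have h0 := (Finset.sum_eq_zero_iff_of_nonneg fun i _ => hterm i).1 hsum i (Finset.mem_univ i)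
  rw [← sub_mul, mul_eq_zero, sub_eq_zero] at h0
  rcases h0 with h | h
  · have h' : lam * z i x = lam * z i y := add_left_cancel (Real.exp_injective h)
    rw [map_sub, mul_left_cancel₀ hlam.ne' h', sub_self]
  · exact h

theorem exists_hasFDerivAt_equiv_expGrad (c : ι → ℝ) {lam : ℝ} (hlam : 0 < lam)
    {z : ι → (κ → ℝ) →L[ℝ] ℝ} (hz : ∀ d, (∀ i, z i d = 0) → d = 0) (γ : κ → ℝ) :
    ∃ e : (κ → ℝ) ≃L[ℝ] (κ → ℝ),
      HasFDerivAt (expGrad c lam z) (e : (κ → ℝ) →L[ℝ] (κ → ℝ)) γ := by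
  have hD := hasFDerivAt_expGrad c lam z γ
  set D := ∑ i, (Real.exp (c i + lam * z i γ) • lam • z i).smulRight
    (fun p => z i (Pi.single p 1)) with hDdef
  have hquad : ∀ d, ∑ p, d p * D d p
      = ∑ i, Real.exp (c i + lam * z i γ) * lam * z i d ^ 2 := by
    intro d
    simp only [hDdef, _root_.sum_apply, ContinuousLinearMap.smulRight_apply,
      Finset.sum_apply, Pi.smul_apply, smul_eq_mul, _root_.smul_apply,
      Finset.mul_sum]
    rw [Finset.sum_comm]
    refine Finset.sum_congr rfl fun i _ => ?_
    calc _ = ∑ p, Real.exp (c i + lam * z i γ) * lam * z i d * (d p * z i (Pi.single p 1)) :=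
          Finset.sum_congr rfl fun p _ => by ring
      _ = _ := by rw [← Finset.mul_sum, sum_mul_apply_single]; ring
  have hinj : Function.Injective (D : (κ → ℝ) →ₗ[ℝ] (κ → ℝ)) := by
    refine (injective_iff_map_eq_zero _).2 fun d hd => hz d fun i => ?_
    have hd' : D d = 0 := hd
    have hsum := hquad d
    simp only [hd', Pi.zero_apply, mul_zero, Finset.sum_const_zero] at hsum
    have h0 := (Finset.sum_eq_zero_iff_of_nonneg fun i _ => by positivity).1 hsum.symm i
      (Finset.mem_univ i)
    simpa [hlam.ne', (Real.exp_pos _).ne'] using h0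
  refine ⟨(LinearEquiv.ofInjectiveEndo _ hinj).toContinuousLinearEquiv, ?_⟩
  convert hD using 1
  ext1 d
  rfl

theorem contDiffAt_leftInverse_expGrad (c : ι → ℝ) {lam : ℝ} (hlam : 0 < lam)
    {z : ι → (κ → ℝ) →L[ℝ] ℝ} (hz : ∀ d, (∀ i, z i d = 0) → d = 0) (γ : κ → ℝ) :
    ∃ g : (κ → ℝ) → (κ → ℝ), ContDiffAt ℝ (⊤ : ℕ∞) g (expGrad c lam z γ) ∧
      ∀ᶠ q in nhds (expGrad c lam z γ), ∀ x, expGrad c lam z x = q → x = g q := by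
  obtain ⟨e, he⟩ := exists_hasFDerivAt_equiv_expGrad c hlam hz γ
  have hG : ContDiffAt ℝ (⊤ : ℕ∞) (expGrad c lam z) γ := (contDiff_expGrad c lam z).contDiffAt
  have hn : ((⊤ : ℕ∞) : WithTop ℕ∞) ≠ 0 := by simp
  refine ⟨hG.localInverse he hn, hG.to_localInverse he hn, ?_⟩
  filter_upwards [(hG.hasStrictFDerivAt' he hn).eventually_right_inverse] with q hq x hx
  exact expGrad_injective c hlam hz (hx.trans hq.symm)

theorem expGrad_eq_of_isMinOn (c : ι → ℝ) {lam : ℝ} (hlam : lam ≠ 0)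
    (z : ι → (κ → ℝ) →L[ℝ] ℝ) (q γ : κ → ℝ)
    (h : IsMinOn (fun γ : κ → ℝ => -(∑ p, γ p * q p)
      + lam⁻¹ * ∑ i, Real.exp (c i + lam * z i γ)) Set.univ γ) :
    expGrad c lam z γ = q := by
  have hmin := h.isLocalMin Filter.univ_mem
  have hpair : HasFDerivAt (fun γ : κ → ℝ => ∑ p, γ p * q p)
      (∑ p, q p • ContinuousLinearMap.proj (R := ℝ) (φ := fun _ : κ => ℝ) p) γ :=
    HasFDerivAt.fun_sum fun p _ => (hasFDerivAt_apply p γ).mul_const (q p)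
  have hexp : HasFDerivAt (fun γ : κ → ℝ => ∑ i, Real.exp (c i + lam * z i γ))
      (∑ i, Real.exp (c i + lam * z i γ) • lam • z i) γ :=
    HasFDerivAt.fun_sum fun i _ => (((z i).hasFDerivAt.const_mul lam).const_add (c i)).exp
  have h0 := hmin.hasFDerivAt_eq_zero (hpair.neg.add (hexp.const_mul lam⁻¹))
  ext p
  have hp := DFunLike.congr_fun h0 (Pi.single p 1)
  simp only [_root_.add_apply, _root_.neg_apply,
    _root_.sum_apply, _root_.smul_apply, smul_eq_mul,
    ContinuousLinearMap.proj_apply, Pi.single_apply, mul_ite, mul_one, mul_zero,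
    Finset.sum_ite_eq', Finset.mem_univ, if_true,
    _root_.zero_apply] at hp
  have hcancel : ∀ i, Real.exp (c i + lam * z i γ) * (lam * z i (Pi.single p 1))
      = lam * (Real.exp (c i + lam * z i γ) * z i (Pi.single p 1)) := fun i => by ring
  simp only [hcancel, ← Finset.mul_sum] at hp
  rw [inv_mul_cancel_left₀ hlam] at hp
  simp only [expGrad, Finset.sum_apply, Pi.smul_apply, smul_eq_mul]
  linarith

end ExpPotential

/-- The functional `(α, β) ↦ α_i + β_j`, with the convention `β_m = 0`. -/
def dualCoord {n k : ℕ} (ij : Fin n × Fin (k + 1)) : (Fin n ⊕ Fin k → ℝ) →L[ℝ] ℝ :=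
  ContinuousLinearMap.proj (R := ℝ) (φ := fun _ : Fin n ⊕ Fin k => ℝ) (Sum.inl ij.1) +
    (Fin.snoc (α := fun _ => (Fin n ⊕ Fin k → ℝ) →L[ℝ] ℝ)
      (fun j => ContinuousLinearMap.proj (R := ℝ) (φ := fun _ : Fin n ⊕ Fin k => ℝ) (Sum.inr j))
      0 ij.2)

theorem dualCoord_apply {n k : ℕ} (i : Fin n) (j : Fin (k + 1)) (γ : Fin n ⊕ Fin k → ℝ) :
    dualCoord (i, j) γ = γ (Sum.inl i) + betaExt (fun j' => γ (Sum.inr j')) j := by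
  refine Fin.lastCases ?_ (fun j => ?_) j <;> simp [dualCoord, betaExt]

theorem eq_zero_of_dualCoord_eq_zero {n k : ℕ} (hn : 1 ≤ n) (d : Fin n ⊕ Fin k → ℝ)
    (hd : ∀ ij, dualCoord ij d = 0) : d = 0 := by
  have hinl : ∀ i, d (Sum.inl i) = 0 := fun i => by
    simpa [dualCoord_apply, betaExt] using hd (i, Fin.last k)
  ext (i | j)
  · exact hinl i
  · simpa [dualCoord_apply, betaExt, hinl] using hd (⟨0, hn⟩, j.castSucc)

theorem dualL_eq {n k : ℕ} (M : Matrix (Fin n) (Fin (k + 1)) ℝ) (lam : ℝ)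
    (a : Fin n → ℝ) (b : Fin (k + 1) → ℝ) :
    dualL M lam a b = fun γ =>
      -(∑ p, γ p * (Sum.elim a (fun j => b j.castSucc) : Fin n ⊕ Fin k → ℝ) p)
      + lam⁻¹ * ∑ ij : Fin n × Fin (k + 1),
        Real.exp (-(lam * M ij.1 ij.2) + lam * dualCoord ij γ) := by
  ext γ
  simp only [dualL, Fintype.sum_sum_type, Fintype.sum_prod_type, Sum.elim_inl, Sum.elim_inr,
    dualCoord_apply, neg_add, ← sub_eq_add_neg]
  congr 2
  refine Finset.sum_congr rfl fun i _ => Finset.sum_congr rfl fun j _ => ?_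
  congr 1
  ring

/-- the map `(a,b) ↦ (α*(a,b), β*(a,b))` sending marginals in the interior of
`Δ_n × Δ_m` (`m = k+1 ≥ 2`) to the unique minimizer of the reduced dual function `𝓛_{a,b}`
(given here by a selection `γsel`) is `C^∞` on the interior of `Δ_n × Δ_m`
(smoothness along the affine subspace, via `ContDiffOn`). -/
theorem statement10 {n k : ℕ} (hn : 1 ≤ n) (hk : 1 ≤ k)
    (M : Matrix (Fin n) (Fin (k + 1)) ℝ) (lam : ℝ) (hlam : 0 < lam)
    (γsel : (Fin n → ℝ) × (Fin (k + 1) → ℝ) → ((Fin n ⊕ Fin k) → ℝ))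
    (hγsel : ∀ p ∈ intSimplexPairs n (k + 1),
      IsMinOn (dualL M lam p.1 p.2) Set.univ (γsel p)) :
    ContDiffOn ℝ (⊤ : ℕ∞) γsel (intSimplexPairs n (k + 1)) := by
  intro p₀ hp₀
  let c : Fin n × Fin (k + 1) → ℝ := fun ij => -(lam * M ij.1 ij.2)
  let target : (Fin n → ℝ) × (Fin (k + 1) → ℝ) → (Fin n ⊕ Fin k → ℝ) :=
    fun p => Sum.elim p.1 (fun j => p.2 j.castSucc)
  have htarget : ContDiff ℝ (⊤ : ℕ∞) target := by
    refine contDiff_pi.2 fun s => ?_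
    rcases s with i | j <;> simp only [target, Sum.elim_inl, Sum.elim_inr] <;> fun_prop
  have hcrit : ∀ p ∈ intSimplexPairs n (k + 1),
      expGrad c lam dualCoord (γsel p) = target p := fun p hp =>
    expGrad_eq_of_isMinOn c hlam.ne' dualCoord (target p) (γsel p)
      (dualL_eq M lam p.1 p.2 ▸ hγsel p hp)
  have hz := eq_zero_of_dualCoord_eq_zero (k := k) hn
  obtain ⟨g, hg, hev⟩ := contDiffAt_leftInverse_expGrad c hlam hz (γsel p₀)
  rw [hcrit p₀ hp₀] at hg hev
  refine (hg.comp p₀ htarget.contDiffAt).contDiffWithinAt.congr_of_eventuallyEq_of_mem ?_ hp₀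
  have hev' := htarget.continuous.continuousAt.eventually hev
  filter_upwards [hev'.filter_mono nhdsWithin_le_nhds, self_mem_nhdsWithin] with p hp hmem
  exact hp _ (hcrit p hmem)
end
end
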